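/- Let m = (1 + √5)/2 (so m² − m − 1 = 0 and m > 0). There do not exist real numbers x₁ > 1 and x₂ > 1 and integers n₁ ≥ 7 and n₂ ≥ 7 such that, setting y₁ = 2·cos(π/n₁) and y₂ = 2·cos(π/n₂), the following three equations hold simultaneously: 24 − 12·y₁² − 12·y₂² + 5·y₁²·y₂² − 28·m + 4·y₁²·m + 4·y₂²·m = 0, and −11 + 11·x₂² + 2·y₂² − 3·y₂²·m = 0, and −11 + 11·x₁² + 2·y₁² − 3·y₁²·m = 0. -/

import Mathlib

open Real

lemma p15_mono {k n : ℕ} (hk : 2 ≤ k) (h : k ≤ n) :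
    cos (2 * π / k) ≤ cos (2 * π / n) := by
  have hk' : (2:ℝ) ≤ k := by exact_mod_cast hk
  have h' : (k:ℝ) ≤ n := by exact_mod_cast h
  have hp := Real.pi_pos
  apply Real.cos_le_cos_of_nonneg_of_le_pi
  · positivity
  · rw [div_le_iff₀ (by linarith)]
    nlinarith
  · gcongr

lemma p15_seven : (0.6225:ℝ) ≤ cos (2 * π / (7:ℕ)) ∧ cos (2 * π / (7:ℕ)) ≤ 0.625 := by
  have h1 : cos (4 * (2 * π / (7:ℕ))) = cos (3 * (2 * π / (7:ℕ))) := by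
    rw [← Real.cos_two_pi_sub]; congr 1; push_cast; ring
  have h4 : cos (4 * (2 * π / (7:ℕ))) = 2 * (2 * cos (2 * π / (7:ℕ)) ^ 2 - 1) ^ 2 - 1 := by
    rw [← Real.cos_two_mul, ← Real.cos_two_mul]; congr 1; ring
  rw [h4, Real.cos_three_mul] at h1
  have hlo : (1/2:ℝ) ≤ cos (2 * π / (7:ℕ)) := by
    have := p15_mono (k := 6) (n := 7) (by norm_num) (by norm_num)
    have h6 : (2 * π / (6:ℕ)) = π / 3 := by push_cast; ring
    rw [h6, Real.cos_pi_div_three] at this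
    exact this
  have hhi : cos (2 * π / (7:ℕ)) < 1 := by
    have hp := Real.pi_pos
    rw [← Real.cos_zero]
    apply Real.cos_lt_cos_of_nonneg_of_le_pi le_rfl
    · push_cast; linarith
    · positivity
  generalize cos (2 * π / (7:ℕ)) = c at *
  have hg : 8 * c ^ 3 + 4 * c ^ 2 - 4 * c - 1 = 0 := by
    have : (c - 1) * (8 * c ^ 3 + 4 * c ^ 2 - 4 * c - 1) = 0 := by linarith
    rcases mul_eq_zero.mp this with h | h
    · linarith
    · exact h
  constructor <;> by_contra! hc <;> nlinarith [mul_pos (sub_pos.2 hc) (sub_pos.2 hc), mul_nonneg (sub_nonneg.2 hlo) (sub_nonneg.2 hc.le), mul_nonneg (mul_nonneg (sub_nonneg.2 hlo) (sub_nonneg.2 hlo)) (sub_nonneg.2 hc.le)]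

lemma p15_eight : (0.705:ℝ) ≤ cos (2 * π / (8:ℕ)) ∧ cos (2 * π / (8:ℕ)) ≤ 0.71 := by
  have h : (2 * π / (8:ℕ)) = π / 4 := by push_cast; ring
  rw [h, Real.cos_pi_div_four]
  have h1 : (1.41:ℝ) ≤ √2 := Real.le_sqrt_of_sq_le (by norm_num)
  have h2 : √2 ≤ (1.42:ℝ) := Real.sqrt_le_iff.2 (by norm_num)
  constructor <;> linarith

lemma p15_sqrt5 : (2.236:ℝ) ≤ √5 ∧ √5 ≤ (2.2361:ℝ) :=
  ⟨Real.le_sqrt_of_sq_le (by norm_num), Real.sqrt_le_iff.2 (by norm_num)⟩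

lemma p15_ten : cos (2 * π / (10:ℕ)) ≤ 0.81 := by
  have h : (2 * π / (10:ℕ)) = π / 5 := by push_cast; ring
  rw [h, Real.cos_pi_div_five]
  linarith [p15_sqrt5.2]

lemma p15_nine : (0.756:ℝ) ≤ cos (2 * π / (9:ℕ)) := by
  have := Real.one_sub_sq_div_two_le_cos (x := 2 * π / (9:ℕ))
  push_cast at *
  nlinarith [Real.pi_lt_d4, Real.pi_pos]

lemma p15_eleven : (0.8365:ℝ) ≤ cos (2 * π / (11:ℕ)) := by
  have := Real.one_sub_sq_div_two_le_cos (x := 2 * π / (11:ℕ))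
  push_cast at *
  nlinarith [Real.pi_lt_d4, Real.pi_pos]

lemma p15_pos {a b a0 b0 m : ℝ} (hm1 : 1.618 ≤ m) (hm2 : m ≤ 1.61805)
    (ha : a0 ≤ a) (hb : b0 ≤ b) (ha0 : 3 ≤ a0) (hb0 : 3 ≤ b0)
    (h0 : 0 < 5 * a0 * b0 - 5.528 * (a0 + b0) - 21.3054)
    (h : 24 - 12 * a - 12 * b + 5 * a * b - 28 * m + 4 * a * m + 4 * b * m = 0) : False := by
  nlinarith [mul_nonneg (sub_nonneg.2 ha) (sub_nonneg.2 hb0), mul_nonneg (sub_nonneg.2 hb) (sub_nonneg.2 (ha0.trans ha)),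
    mul_nonneg (sub_nonneg.2 hm1) (sub_nonneg.2 (ha0.trans ha)), mul_nonneg (sub_nonneg.2 hm1) (sub_nonneg.2 (hb0.trans hb))]

lemma p15_neg {a b a0 b0 m : ℝ} (hm1 : 1.618 ≤ m) (hm2 : m ≤ 1.61805)
    (ha : a ≤ a0) (hb : b ≤ b0) (ha0 : 3 ≤ a) (hb0 : 3 ≤ b)
    (h0 : 5 * a0 * b0 - 5.5278 * (a0 + b0) - 21.304 < 0)
    (h : 24 - 12 * a - 12 * b + 5 * a * b - 28 * m + 4 * a * m + 4 * b * m = 0) : False := by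
  nlinarith [mul_nonneg (sub_nonneg.2 ha) (sub_nonneg.2 hb0), mul_nonneg (sub_nonneg.2 hb) (sub_nonneg.2 (ha0.trans ha)),
    mul_nonneg (sub_nonneg.2 hm2) (sub_nonneg.2 ha0), mul_nonneg (sub_nonneg.2 hm2) (sub_nonneg.2 hb0)]

lemma p15_wlog {m : ℝ} (hm1 : 1.618 ≤ m) (hm2 : m ≤ 1.61805) {k n : ℕ} (hk : 7 ≤ k) (hn : k ≤ n)
    {a b : ℝ} (ha : a = 2 + 2 * cos (2 * π / k)) (hb : b = 2 + 2 * cos (2 * π / n))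
    (h : 24 - 12 * a - 12 * b + 5 * a * b - 28 * m + 4 * a * m + 4 * b * m = 0) : False := by
  have a7 := p15_mono (by norm_num) hk
  have b7 := p15_mono (by norm_num) (hk.trans hn)
  have h7 := p15_seven
  have h8 := p15_eight
  by_cases k7 : k = 7
  · subst k7
    by_cases hn10 : n ≤ 10
    · have := p15_mono (by omega) hn10
      have := p15_ten
      exact p15_neg (a0 := 3.25) (b0 := 3.62) hm1 hm2 (by linarith) (by linarith) (by linarith)
        (by linarith) (by norm_num) h
    · have := p15_mono (k := 11) (n := n) (by omega) (by omega)
      have := p15_eleven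
      exact p15_pos (a0 := 3.245) (b0 := 3.673) hm1 hm2 (by linarith) (by linarith) (by norm_num)
        (by norm_num) (by norm_num) h
  · have a8 := p15_mono (k := 8) (n := k) (by omega) (by omega)
    by_cases hn8 : n = 8
    · obtain rfl : k = 8 := by omega
      subst hn8
      exact p15_neg (a0 := 3.42) (b0 := 3.42) hm1 hm2 (by linarith) (by linarith) (by linarith)
        (by linarith) (by norm_num) h
    · have := p15_mono (k := 9) (n := n) (by omega) (by omega)
      have := p15_nine
      exact p15_pos (a0 := 3.41) (b0 := 3.512) hm1 hm2 (by linarith) (by linarith) (by norm_num)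
        (by norm_num) (by norm_num) h

lemma p15_sq {y : ℝ} {n : ℕ} (h : y = 2 * Real.cos (Real.pi / n)) :
    y ^ 2 = 2 + 2 * cos (2 * π / n) := by
  rw [h, mul_div_assoc, Real.cos_two_mul]; ring





/-- The system (6.3) of Example 6.1 of the paper, arising from the Coxeter vector
`{2, 2, 2, 7, 2, ∞, 7, 2, 2, 2, ∞, 3, 2, 2, 2, 2, 5, 2, 3, 2, 2}` over the combinatorial
polytope `P₁₅`, admits no admissible solution. -/
theorem p15_system_no_solution (m : ℝ) (hm : m = (1 + Real.sqrt 5) / 2) :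
    ¬ ∃ (x₁ x₂ y₁ y₂ : ℝ) (n₁ n₂ : ℕ), 1 < x₁ ∧ 1 < x₂ ∧ 7 ≤ n₁ ∧ 7 ≤ n₂ ∧
      y₁ = 2 * Real.cos (Real.pi / n₁) ∧ y₂ = 2 * Real.cos (Real.pi / n₂) ∧
      24 - 12 * y₁ ^ 2 - 12 * y₂ ^ 2 + 5 * y₁ ^ 2 * y₂ ^ 2
        - 28 * m + 4 * y₁ ^ 2 * m + 4 * y₂ ^ 2 * m = 0 ∧
      -11 + 11 * x₂ ^ 2 + 2 * y₂ ^ 2 - 3 * y₂ ^ 2 * m = 0 ∧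
      -11 + 11 * x₁ ^ 2 + 2 * y₁ ^ 2 - 3 * y₁ ^ 2 * m = 0 := by
  rintro ⟨x₁, x₂, y₁, y₂, n₁, n₂, -, -, h₁, h₂, e₁, e₂, h, -, -⟩
  have hm1 : 1.618 ≤ m := by linarith [p15_sqrt5.1]
  have hm2 : m ≤ 1.61805 := by linarith [p15_sqrt5.2]
  rcases le_total n₁ n₂ with hl | hl
  · exact p15_wlog hm1 hm2 h₁ hl (p15_sq e₁) (p15_sq e₂) h
  · exact p15_wlog hm1 hm2 h₂ hl (p15_sq e₂) (p15_sq e₁) (by linarith)
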